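/- arXiv:1903.01112 — 3 statements merged into one kernel-verified Lean document; each statement's English description precedes it below -/
import Mathlib

section
/- Let α₁ ∈ 𝔐(Ω₁) and α₂ ∈ 𝔐(Ω₂) be Radon measures with ∫_{Ω₂} dα₂ = 0. Then ‖α₁‖_𝔐 ≤ (1/|Ω₂|)·‖α₁ ⊕ α₂‖_𝔐 and ‖α₂‖_𝔐 ≤ (2/|Ω₁|)·‖α₁ ⊕ α₂‖_𝔐. -/
open MeasureTheory Filter ENNReal

/-- The outer sum `α₁ ⊕ α₂ := α₁ ⊗ ν₂ + ν₁ ⊗ α₂` of two signed (Radon) measures,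
defined via their Jordan decompositions. -/
noncomputable def oplusSM {X Y : Type*} [MeasurableSpace X] [MeasurableSpace Y]
    (s₁ : SignedMeasure X) (s₂ : SignedMeasure Y)
    (ν₁ : Measure X) (ν₂ : Measure Y) [IsFiniteMeasure ν₁] [IsFiniteMeasure ν₂] :
    SignedMeasure (X × Y) :=
  ((s₁.toJordanDecomposition.posPart.prod ν₂).toSignedMeasure
      - (s₁.toJordanDecomposition.negPart.prod ν₂).toSignedMeasure)
    + ((ν₁.prod s₂.toJordanDecomposition.posPart).toSignedMeasure
      - (ν₁.prod s₂.toJordanDecomposition.negPart).toSignedMeasure)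

/-- The total mass of a signed measure is attained on a Hahn decomposition. -/
theorem exists_toReal_totalVariation_univ_eq {X : Type*} [MeasurableSpace X]
    (s : SignedMeasure X) :
    ∃ i, MeasurableSet i ∧ (s.totalVariation Set.univ).toReal = s i - s iᶜ := by
  obtain ⟨i, hi, _, _, hp, hn⟩ := s.toJordanDecomposition_spec
  refine ⟨i, hi, ?_⟩
  rw [← measureReal_def, SignedMeasure.totalVariation, measureReal_add_apply, hp, hn,
    SignedMeasure.toMeasureOfZeroLE_real_apply _ _ _ .univ,
    SignedMeasure.toMeasureOfLEZero_real_apply _ _ _ .univ, Set.inter_univ, Set.inter_univ,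
    sub_eq_add_neg]

/-- The difference of the values of a signed measure on complementary sets is at most its
total mass. -/
theorem sub_compl_le_toReal_totalVariation {X : Type*} [MeasurableSpace X]
    (s : SignedMeasure X) {E : Set X} (hE : MeasurableSet E) :
    s E - s Eᶜ ≤ (s.totalVariation Set.univ).toReal := by
  rw [← measureReal_def, ← measureReal_add_measureReal_compl hE]
  have h₁ := (abs_le.1 (s.norm_le_totalVariation E)).2
  have h₂ := (abs_le.1 (s.norm_le_totalVariation Eᶜ)).1
  linarith

/-- The value of the outer sum on a measurable rectangle. -/
theorem oplusSM_prod {X Y : Type*} [MeasurableSpace X] [MeasurableSpace Y]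
    (s₁ : SignedMeasure X) (s₂ : SignedMeasure Y)
    (ν₁ : Measure X) (ν₂ : Measure Y) [IsFiniteMeasure ν₁] [IsFiniteMeasure ν₂]
    {A : Set X} {B : Set Y} (hA : MeasurableSet A) (hB : MeasurableSet B) :
    oplusSM s₁ s₂ ν₁ ν₂ (A ×ˢ B) = s₁ A * ν₂.real B + ν₁.real A * s₂ B := by
  rw [s₁.apply_eq_posPart_real_sub_negPart_real hA,
    s₂.apply_eq_posPart_real_sub_negPart_real hB]
  simp only [oplusSM, _root_.add_apply, _root_.sub_apply,
    Measure.toSignedMeasure_apply_measurable (hA.prod hB), measureReal_prod_prod]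
  ring

/-- If `α₁ ∈ 𝔐(Ω₁)`, `α₂ ∈ 𝔐(Ω₂)` and `∫_{Ω₂} dα₂ = 0`, then
`‖α₁‖_𝔐 ≤ (1/|Ω₂|) ‖α₁ ⊕ α₂‖_𝔐` and `‖α₂‖_𝔐 ≤ (2/|Ω₁|) ‖α₁ ⊕ α₂‖_𝔐`. -/
theorem stmt_4 {d₁ d₂ : ℕ}
    (Ω₁ : Set (Fin d₁ → ℝ)) (Ω₂ : Set (Fin d₂ → ℝ))
    (hΩ₁ : IsCompact Ω₁) (hΩ₂ : IsCompact Ω₂)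
    (hΩ₁pos : 0 < volume Ω₁) (hΩ₂pos : 0 < volume Ω₂)
    (lam₁ : Measure (Fin d₁ → ℝ)) (lam₂ : Measure (Fin d₂ → ℝ))
    [IsFiniteMeasure lam₁] [IsFiniteMeasure lam₂]
    (hlam₁ : lam₁ = volume.restrict Ω₁) (hlam₂ : lam₂ = volume.restrict Ω₂)
    (α₁ : SignedMeasure (Fin d₁ → ℝ)) (α₂ : SignedMeasure (Fin d₂ → ℝ))
    (hα₁supp : α₁.totalVariation Ω₁ᶜ = 0) (hα₂supp : α₂.totalVariation Ω₂ᶜ = 0)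
    (hzero : α₂ Set.univ = 0) :
    (α₁.totalVariation Set.univ).toReal
        ≤ 1 / (volume Ω₂).toReal *
          ((oplusSM α₁ α₂ lam₁ lam₂).totalVariation Set.univ).toReal ∧
    (α₂.totalVariation Set.univ).toReal
        ≤ 2 / (volume Ω₁).toReal *
          ((oplusSM α₁ α₂ lam₁ lam₂).totalVariation Set.univ).toReal := by
  set σ := oplusSM α₁ α₂ lam₁ lam₂ with hσ
  have hm₁ : lam₁.real Set.univ = (volume Ω₁).toReal := by simp [hlam₁, measureReal_def]
  have hm₂ : lam₂.real Set.univ = (volume Ω₂).toReal := by simp [hlam₂, measureReal_def]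
  have hv₁ : 0 < (volume Ω₁).toReal := toReal_pos hΩ₁pos.ne' hΩ₁.measure_lt_top.ne
  have hv₂ : 0 < (volume Ω₂).toReal := toReal_pos hΩ₂pos.ne' hΩ₂.measure_lt_top.ne
  have hleft {A : Set (Fin d₁ → ℝ)} (hA : MeasurableSet A) :
      σ (A ×ˢ Set.univ) = α₁ A * (volume Ω₂).toReal := by
    rw [hσ, oplusSM_prod _ _ _ _ hA .univ, hzero, hm₂, mul_zero, add_zero]
  have hright {B : Set (Fin d₂ → ℝ)} (hB : MeasurableSet B) :
      σ (Set.univ ×ˢ B) = α₁ Set.univ * lam₂.real B + (volume Ω₁).toReal * α₂ B := by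
    rw [hσ, oplusSM_prod _ _ _ _ .univ hB, hm₁]
  constructor
  · obtain ⟨i, hi, h⟩ := exists_toReal_totalVariation_univ_eq α₁
    have hle := sub_compl_le_toReal_totalVariation σ (hi.prod (.univ (α := Fin d₂ → ℝ)))
    have hc : (i ×ˢ (Set.univ : Set (Fin d₂ → ℝ)))ᶜ = iᶜ ×ˢ Set.univ := by ext; simp
    rw [hc, hleft hi, hleft hi.compl] at hle
    rw [h, one_div_mul_eq_div, le_div_iff₀ hv₂]
    linarith
  · obtain ⟨j, hj, h⟩ := exists_toReal_totalVariation_univ_eq α₂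
    have hle := sub_compl_le_toReal_totalVariation σ
      ((MeasurableSet.univ (α := Fin d₁ → ℝ)).prod hj)
    have hc : ((Set.univ : Set (Fin d₁ → ℝ)) ×ˢ j)ᶜ = Set.univ ×ˢ jᶜ := by ext; simp
    rw [hc, hright hj, hright hj.compl] at hle
    have hmass := σ.norm_le_totalVariation Set.univ
    rw [← Set.univ_prod_univ, hleft .univ, Real.norm_eq_abs, abs_mul, abs_of_pos hv₂,
      Set.univ_prod_univ, measureReal_def] at hmass
    have hsum : lam₂.real j + lam₂.real jᶜ = (volume Ω₂).toReal := by
      rw [← hm₂, measureReal_add_measureReal_compl hj]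
    have hdiff : |lam₂.real j - lam₂.real jᶜ| ≤ (volume Ω₂).toReal := by
      have := measureReal_nonneg (μ := lam₂) (s := j)
      have := measureReal_nonneg (μ := lam₂) (s := jᶜ)
      rw [abs_le]
      constructor <;> linarith
    have hbd : |α₁ Set.univ * (lam₂.real j - lam₂.real jᶜ)|
        ≤ |α₁ Set.univ| * (volume Ω₂).toReal := by
      rw [abs_mul]
      gcongr
    have := (abs_le.1 hbd).1
    rw [h, div_mul_eq_mul_div, le_div_iff₀ hv₁]
    linarith
end

section
/- Let c ∈ L¹(Ω) and let αᵢ ∈ 𝔐(Ωᵢ), i = 1,2, have Lebesgue decompositions αᵢ = fᵢ + ηᵢ with fᵢ ≪ λᵢ and ηᵢ ⊥ λᵢ. Then the Hahn–Jordan positive part satisfies (α₁ ⊕ α₂ − c)₊ = (f₁ ⊕ f₂ − c + (η₁)₊ ⊕ (η₂)₊)₊ as Radon measures on Ω, where (ηᵢ)₊ denotes the Hahn–Jordan positive part of ηᵢ. -/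
open MeasureTheory Filter ENNReal

namespace MeasureTheory

variable {X Y : Type*} [MeasurableSpace X] [MeasurableSpace Y]

lemma Measure.MutuallySingular.prod_left {μ μ' : Measure X} {ν ν' : Measure Y} [SFinite ν]
    [SFinite ν'] (h : μ ⟂ₘ μ') : μ.prod ν ⟂ₘ μ'.prod ν' := by
  obtain ⟨s, -, hμ, hμ'⟩ := h
  refine Measure.MutuallySingular.mk (s := s ×ˢ Set.univ) (t := sᶜ ×ˢ Set.univ) ?_ ?_ ?_
  · simp [Measure.prod_prod, hμ]
  · simp [Measure.prod_prod, hμ']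
  · simp [← Set.union_prod]

lemma Measure.MutuallySingular.prod_right {μ μ' : Measure X} {ν ν' : Measure Y} [SFinite ν]
    [SFinite ν'] (h : ν ⟂ₘ ν') : μ.prod ν ⟂ₘ μ'.prod ν' := by
  obtain ⟨s, -, hν, hν'⟩ := h
  refine Measure.MutuallySingular.mk (s := Set.univ ×ˢ s) (t := Set.univ ×ˢ sᶜ) ?_ ?_ ?_
  · simp [Measure.prod_prod, hν]
  · simp [Measure.prod_prod, hν']
  · simp [← Set.prod_union]

namespace SignedMeasure

lemma posPart_sub_toSignedMeasure_le (P N : Measure X) [IsFiniteMeasure P] [IsFiniteMeasure N] :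
    (P.toSignedMeasure - N.toSignedMeasure).toJordanDecomposition.posPart ≤ P := by
  rw [Measure.toJordanDecomposition_toSignedMeasure_sub]
  exact Measure.sub_le

/-- Subtracting a positive measure that is singular to the positive part of a signed measure does
not change that positive part. -/
lemma posPart_sub_of_mutuallySingular (s : SignedMeasure X) (ρ : Measure X) [IsFiniteMeasure ρ]
    (h : ρ ⟂ₘ s.toJordanDecomposition.posPart) :
    (s - ρ.toSignedMeasure).toJordanDecomposition.posPart = s.toJordanDecomposition.posPart := by
  let j : JordanDecomposition X :=
    ⟨s.toJordanDecomposition.posPart, s.toJordanDecomposition.negPart + ρ,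
      s.toJordanDecomposition.mutuallySingular.add_right h.symm⟩
  have hj : s - ρ.toSignedMeasure = j.toSignedMeasure := by
    conv_lhs => rw [← s.toSignedMeasure_toJordanDecomposition]
    simp only [JordanDecomposition.toSignedMeasure, j, Measure.toSignedMeasure_add]
    abel
  rw [toJordanDecomposition_eq hj]

lemma posPart_add_posPart_add_negPart (s t : SignedMeasure X) :
    (s + t).toJordanDecomposition.posPart
        + (s.toJordanDecomposition.negPart + t.toJordanDecomposition.negPart)
      = s.toJordanDecomposition.posPart + t.toJordanDecomposition.posPart
        + (s + t).toJordanDecomposition.negPart := by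
  rw [← Measure.toSignedMeasure_eq_toSignedMeasure_iff]
  simp only [Measure.toSignedMeasure_add]
  have hst := (s + t).toSignedMeasure_toJordanDecomposition
  have hs := s.toSignedMeasure_toJordanDecomposition
  have ht := t.toSignedMeasure_toJordanDecomposition
  simp only [JordanDecomposition.toSignedMeasure] at hst hs ht
  linear_combination (norm := module) hst - hs - ht

end SignedMeasure

end MeasureTheory

lemma oplusSM_add {X Y : Type*} [MeasurableSpace X] [MeasurableSpace Y]
    (s₁ t₁ : SignedMeasure X) (s₂ t₂ : SignedMeasure Y)
    (ν₁ : Measure X) (ν₂ : Measure Y) [IsFiniteMeasure ν₁] [IsFiniteMeasure ν₂] :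
    oplusSM (s₁ + t₁) (s₂ + t₂) ν₁ ν₂ = oplusSM s₁ s₂ ν₁ ν₂ + oplusSM t₁ t₂ ν₁ ν₂ := by
  have h₁ := Measure.toSignedMeasure_congr
    (congrArg (fun μ => μ.prod ν₂) (s₁.posPart_add_posPart_add_negPart t₁))
  have h₂ := Measure.toSignedMeasure_congr
    (congrArg (fun μ => ν₁.prod μ) (s₂.posPart_add_posPart_add_negPart t₂))
  simp only [Measure.add_prod, Measure.prod_add, Measure.toSignedMeasure_add] at h₁ h₂
  simp only [oplusSM]
  linear_combination (norm := module) h₁ + h₂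

/-- With Lebesgue decompositions `αᵢ = fᵢ + ηᵢ` (`fᵢ ≪ λᵢ`, `ηᵢ ⊥ λᵢ`) and `c ∈ L¹(Ω)`,
the Hahn–Jordan positive parts satisfy
`(α₁ ⊕ α₂ − c)₊ = (f₁ ⊕ f₂ − c + (η₁)₊ ⊕ (η₂)₊)₊`. -/
theorem stmt_5 {d₁ d₂ : ℕ}
    (Ω₁ : Set (Fin d₁ → ℝ)) (Ω₂ : Set (Fin d₂ → ℝ))
    (hΩ₁ : IsCompact Ω₁) (hΩ₂ : IsCompact Ω₂)
    (lam₁ : Measure (Fin d₁ → ℝ)) (lam₂ : Measure (Fin d₂ → ℝ))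
    [IsFiniteMeasure lam₁] [IsFiniteMeasure lam₂]
    (hlam₁ : lam₁ = volume.restrict Ω₁) (hlam₂ : lam₂ = volume.restrict Ω₂)
    (c : (Fin d₁ → ℝ) × (Fin d₂ → ℝ) → ℝ) (hc : Integrable c (lam₁.prod lam₂))
    (α₁ f₁ η₁ : SignedMeasure (Fin d₁ → ℝ)) (α₂ f₂ η₂ : SignedMeasure (Fin d₂ → ℝ))
    (hdec₁ : α₁ = f₁ + η₁) (hdec₂ : α₂ = f₂ + η₂)
    (hf₁ : f₁.totalVariation ≪ lam₁) (hf₂ : f₂.totalVariation ≪ lam₂)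
    (hη₁ : η₁.totalVariation ⟂ₘ lam₁) (hη₂ : η₂.totalVariation ⟂ₘ lam₂) :
    (oplusSM α₁ α₂ lam₁ lam₂
        - (lam₁.prod lam₂).withDensityᵥ c).toJordanDecomposition.posPart
      = (oplusSM f₁ f₂ lam₁ lam₂ - (lam₁.prod lam₂).withDensityᵥ c
          + ((η₁.toJordanDecomposition.posPart.prod lam₂).toSignedMeasure
            + (lam₁.prod η₂.toJordanDecomposition.posPart).toSignedMeasure)
        ).toJordanDecomposition.posPart := by
  set lam := lam₁.prod lam₂
  set P₁ := f₁.toJordanDecomposition.posPart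
  set N₁ := f₁.toJordanDecomposition.negPart
  set P₂ := f₂.toJordanDecomposition.posPart
  set N₂ := f₂.toJordanDecomposition.negPart
  set p₁ := η₁.toJordanDecomposition.posPart
  set n₁ := η₁.toJordanDecomposition.negPart
  set p₂ := η₂.toJordanDecomposition.posPart
  set n₂ := η₂.toJordanDecomposition.negPart
  have hP₁ : P₁ ≪ lam₁ := (Measure.le_add_right le_rfl).absolutelyContinuous.trans hf₁
  have hP₂ : P₂ ≪ lam₂ := (Measure.le_add_right le_rfl).absolutelyContinuous.trans hf₂
  have hn₁ : n₁ ⟂ₘ lam₁ := hη₁.mono (Measure.le_add_left le_rfl) le_rfl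
  have hn₂ : n₂ ⟂ₘ lam₂ := hη₂.mono (Measure.le_add_left le_rfl) le_rfl
  have hnp₁ : n₁ ⟂ₘ p₁ := η₁.toJordanDecomposition.mutuallySingular.symm
  have hnp₂ : n₂ ⟂ₘ p₂ := η₂.toJordanDecomposition.mutuallySingular.symm
  have := isFiniteMeasure_withDensity_ofReal hc.2
  have := isFiniteMeasure_withDensity_ofReal hc.neg.2
  have hρ : n₁.prod lam₂ + lam₁.prod n₂ ⟂ₘ
      P₁.prod lam₂ + lam₁.prod P₂ + lam.withDensity (fun x => ENNReal.ofReal (-c x))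
        + (p₁.prod lam₂ + lam₁.prod p₂) := by
    have hlam₁' : n₁.prod lam₂ ⟂ₘ lam := hn₁.prod_left
    have hlam₂' : lam₁.prod n₂ ⟂ₘ lam := hn₂.prod_right
    have hac : P₁.prod lam₂ + lam₁.prod P₂ + lam.withDensity (fun x => ENNReal.ofReal (-c x))
        ≪ lam :=
      ((hP₁.prod .rfl).add_left (.prod .rfl hP₂)).add_left (withDensity_absolutelyContinuous _ _)
    refine .add_left ?_ ?_
    · exact (hlam₁'.mono_ac .rfl hac).add_right (hnp₁.prod_left.add_right hn₁.prod_left)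
    · exact (hlam₂'.mono_ac .rfl hac).add_right (hn₂.prod_right.add_right hnp₂.prod_right)
  have hrhs : oplusSM f₁ f₂ lam₁ lam₂ - lam.withDensityᵥ c
        + ((p₁.prod lam₂).toSignedMeasure + (lam₁.prod p₂).toSignedMeasure)
      = (P₁.prod lam₂ + lam₁.prod P₂ + lam.withDensity (fun x => ENNReal.ofReal (-c x))
          + (p₁.prod lam₂ + lam₁.prod p₂)).toSignedMeasure
        - (N₁.prod lam₂ + lam₁.prod N₂
          + lam.withDensity (fun x => ENNReal.ofReal (c x))).toSignedMeasure := by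
    rw [withDensityᵥ_eq_withDensity_pos_part_sub_withDensity_neg_part hc]
    simp only [oplusSM, Measure.toSignedMeasure_add]
    abel
  have hlhs : oplusSM α₁ α₂ lam₁ lam₂ - lam.withDensityᵥ c
      = oplusSM f₁ f₂ lam₁ lam₂ - lam.withDensityᵥ c
          + ((p₁.prod lam₂).toSignedMeasure + (lam₁.prod p₂).toSignedMeasure)
        - (n₁.prod lam₂ + lam₁.prod n₂).toSignedMeasure := by
    rw [hdec₁, hdec₂, oplusSM_add, oplusSM.eq_def η₁ η₂, Measure.toSignedMeasure_add]
    abel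
  rw [hlhs]
  refine SignedMeasure.posPart_sub_of_mutuallySingular _ _ (hρ.mono le_rfl ?_)
  rw [hrhs]
  exact SignedMeasure.posPart_sub_toSignedMeasure_le _ _
end

section
/- Let σ ∈ ℝ^{M×N} be defined by σᵢⱼ = 1 if αᵢ + βⱼ − cᵢⱼ ≥ 0 and σᵢⱼ = 0 otherwise, and let G ∈ ℝ^{(M+N)×(M+N)} be the block matrix G = [[diag(σ·1_N), σ], [σᵀ, diag(σᵀ·1_M)]]. Then (a,b) ∈ ℝ^M × ℝ^N belongs to the kernel of G if and only if σᵢⱼ(aᵢ + bⱼ) = 0 for all 1 ≤ i ≤ M and 1 ≤ j ≤ N. -/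
open Finset Matrix

section NewtonKernel

variable {m n : Type*} [Fintype m] [Fintype n]

/-- The kernel of `[[diag(σ 1), σ], [σᵀ, diag(σᵀ 1)]]` is cut out by the vanishing of the row and
column sums of `σᵢⱼ (aᵢ + bⱼ)`. -/
lemma fromBlocks_diagonal_sums_mulVec_eq_zero_iff [DecidableEq m] [DecidableEq n]
    {R : Type*} [CommRing R] (σ : Matrix m n R) (a : m → R) (b : n → R) :
    (Matrix.fromBlocks (Matrix.diagonal fun i => ∑ j, σ i j) σ
      σ.transpose (Matrix.diagonal fun j => ∑ i, σ i j)).mulVec (Sum.elim a b) = 0 ↔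
    (∀ i, ∑ j, σ i j * (a i + b j) = 0) ∧ ∀ j, ∑ i, σ i j * (a i + b j) = 0 := by
  rw [Matrix.fromBlocks_mulVec, funext_iff, Sum.forall]
  refine and_congr (forall_congr' fun i => ?_) (forall_congr' fun j => ?_)
  · simp [Matrix.mulVec, dotProduct, Matrix.diagonal_apply, mul_add, sum_add_distrib, sum_mul]
  · simp [Matrix.mulVec, dotProduct, Matrix.diagonal_apply, mul_add, sum_add_distrib, sum_mul]

/-- For nonnegative weights, the row and column sums of `σᵢⱼ (aᵢ + bⱼ)` vanish only if every
entry does. -/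
lemma forall_mul_add_eq_zero_of_sums_eq_zero {R : Type*} [CommRing R] [LinearOrder R]
    [IsStrictOrderedRing R] {σ : Matrix m n R} (hσ : ∀ i j, 0 ≤ σ i j) {a : m → R} {b : n → R}
    (hrow : ∀ i, ∑ j, σ i j * (a i + b j) = 0) (hcol : ∀ j, ∑ i, σ i j * (a i + b j) = 0)
    (i : m) (j : n) : σ i j * (a i + b j) = 0 := by
  have hquad : ∑ i, ∑ j, σ i j * (a i + b j) ^ 2 = 0 := by
    calc ∑ i, ∑ j, σ i j * (a i + b j) ^ 2
        = ∑ i, a i * ∑ j, σ i j * (a i + b j) + ∑ j, b j * ∑ i, σ i j * (a i + b j) := by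
          simp only [mul_sum]
          rw [sum_comm (s := (univ : Finset n)), ← sum_add_distrib]
          refine sum_congr rfl fun i _ => ?_
          rw [← sum_add_distrib]
          exact sum_congr rfl fun j _ => by ring
      _ = 0 := by simp [hrow, hcol]
  have hnn : ∀ i j, 0 ≤ σ i j * (a i + b j) ^ 2 := fun i j => mul_nonneg (hσ i j) (sq_nonneg _)
  have hi := (sum_eq_zero_iff_of_nonneg fun i _ => sum_nonneg fun j _ => hnn i j).1 hquad i
    (mem_univ i)
  have hij := (sum_eq_zero_iff_of_nonneg fun j _ => hnn i j).1 hi j (mem_univ j)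
  simpa using hij

end NewtonKernel

/-- Kernel characterization of the Newton matrix
`G = [[diag(σ 1_N), σ], [σᵀ, diag(σᵀ 1_M)]]`: the vector `(a,b)` lies in the kernel of
`G` iff `σᵢⱼ (aᵢ + bⱼ) = 0` for all `i, j`. -/
theorem stmt_19 (M N : ℕ) (c : Matrix (Fin M) (Fin N) ℝ)
    (α : Fin M → ℝ) (β : Fin N → ℝ)
    (σ : Matrix (Fin M) (Fin N) ℝ)
    (hσ : ∀ i j, σ i j = if 0 ≤ α i + β j - c i j then 1 else 0)
    (G : Matrix (Fin M ⊕ Fin N) (Fin M ⊕ Fin N) ℝ)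
    (hG : G = Matrix.fromBlocks
      (Matrix.diagonal fun i => ∑ j, σ i j) σ
      σ.transpose (Matrix.diagonal fun j => ∑ i, σ i j)) :
    ∀ (a : Fin M → ℝ) (b : Fin N → ℝ),
      G.mulVec (Sum.elim a b) = 0 ↔ ∀ i j, σ i j * (a i + b j) = 0 := by
  intro a b
  rw [hG, fromBlocks_diagonal_sums_mulVec_eq_zero_iff]
  have hnn : ∀ i j, 0 ≤ σ i j := fun i j => by
    rw [hσ]
    split_ifs <;> simp
  exact ⟨fun h => forall_mul_add_eq_zero_of_sums_eq_zero hnn h.1 h.2,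
    fun h => ⟨fun i => sum_eq_zero fun j _ => h i j, fun j => sum_eq_zero fun i _ => h i j⟩⟩
end
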